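/- There exists a linear operator div⁻¹ mapping smooth zero-mean vector fields u: T^d → ℝ^d to smooth zero-mean symmetric-matrix-valued fields div⁻¹u : T^d → Sym(d), such that div(div⁻¹u) = u (row-wise divergence), and for every i ≥ 0 and p ∈ [1,∞] there are constants C_{i,p} with: |∇^i(div⁻¹u)|_{L^p(T^d)} ≤ C_{i,p} |∇^i u|_{L^p(T^d)} for all such u, and moreover for every λ ∈ ℕ, |∇^i(div⁻¹(u(λ·)))|_{L^p(T^d)} ≤ C_{i,p} λ^{i−1} |∇^i u|_{L^p(T^d)}. -/

import Mathlib

open MeasureTheory ENNReal NNReal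

noncomputable section

namespace NonNewtonian

abbrev Pt (d : ℕ) := Fin d → ℝ
abbrev Vec (d : ℕ) := Fin d → ℝ
abbrev Mat (d : ℕ) := Fin d → Fin d → ℝ

/-- The fundamental domain `[0,1]^d` of the torus `T^d = ℝ^d/ℤ^d`. -/
def box (d : ℕ) : Set (Pt d) := Set.Icc 0 1

/-- Lebesgue measure restricted to the fundamental domain. -/
def μbox (d : ℕ) : Measure (Pt d) := volume.restrict (box d)

/-- `ℤ^d`-periodicity (functions on the torus). -/
def ZPer {d : ℕ} {α : Type*} (f : Pt d → α) : Prop :=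
  ∀ (x : Pt d) (m : Fin d → ℤ), f (x + fun i => (m i : ℝ)) = f x

/-- Row-wise divergence of a matrix field. -/
def divMat {d : ℕ} (R : Pt d → Mat d) (x : Pt d) : Vec d :=
  fun i => ∑ j, fderiv ℝ (fun y => R y i j) x (Pi.single j 1)

/-- Smooth, `ℤ^d`-periodic, zero-mean vector fields on the torus. -/
def AdmissibleVec (d : ℕ) (u : Pt d → Vec d) : Prop :=
  ContDiff ℝ ((⊤:ℕ∞)) u ∧ ZPer u ∧ ∀ i, (∫ x in box d, u x i) = 0

section LineAvg

variable {d : ℕ} {E F : Type*} [NormedAddCommGroup E] [NormedSpace ℝ E]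
  [NormedAddCommGroup F] [NormedSpace ℝ F]

/-- The average of `f` over the segment from `x` to `x + v`, weighted by `κ`. -/
def lineAvg (κ : ℝ → ℝ) (v : Pt d) (f : Pt d → E) (x : Pt d) : E :=
  ∫ s in (0 : ℝ)..1, κ s • f (x + s • v)

variable {κ : ℝ → ℝ} {v : Pt d} {f g : Pt d → E}

theorem continuous_lineAvg_integrand (hκ : Continuous κ) (hf : Continuous f) :
    Continuous fun q : Pt d × ℝ => κ q.2 • f (q.1 + q.2 • v) := by
  fun_prop

theorem intervalIntegrable_lineAvg (hκ : Continuous κ) (hf : Continuous f) (x : Pt d) :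
    IntervalIntegrable (fun s => κ s • f (x + s • v)) volume 0 1 := by
  apply Continuous.intervalIntegrable
  fun_prop

theorem continuous_lineAvg (hκ : Continuous κ) (hf : Continuous f) :
    Continuous (lineAvg κ v f) :=
  intervalIntegral.continuous_parametric_intervalIntegral_of_continuous'
    (continuous_lineAvg_integrand hκ hf) 0 1

theorem lineAvg_add (hκ : Continuous κ) (hf : Continuous f) (hg : Continuous g) :
    lineAvg κ v (f + g) = lineAvg κ v f + lineAvg κ v g := by
  ext x
  simp only [lineAvg, Pi.add_apply, smul_add]
  exact intervalIntegral.integral_add (intervalIntegrable_lineAvg hκ hf x)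
    (intervalIntegrable_lineAvg hκ hg x)

theorem lineAvg_smul (c : ℝ) : lineAvg κ v (c • f) = c • lineAvg κ v f := by
  ext x
  simp only [lineAvg, Pi.smul_apply, smul_comm _ c, intervalIntegral.integral_smul]

theorem clm_lineAvg [CompleteSpace E] [CompleteSpace F] (hκ : Continuous κ) (hf : Continuous f)
    (L : E →L[ℝ] F) (x : Pt d) :
    L (lineAvg κ v f x) = lineAvg κ v (fun y => L (f y)) x := by
  rw [lineAvg, ← L.intervalIntegral_comp_comm (intervalIntegrable_lineAvg hκ hf x)]
  simp [lineAvg]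

theorem lineAvg_add_of_forall {h : Pt d} (hf : ∀ x, f (x + h) = f x) (x : Pt d) :
    lineAvg κ v f (x + h) = lineAvg κ v f x := by
  simp only [lineAvg, add_right_comm x h, hf]

theorem hasFDerivAt_lineAvg (hκ : Continuous κ) (hf : ContDiff ℝ 1 f) (x : Pt d) :
    HasFDerivAt (lineAvg κ v f) (lineAvg κ v (fderiv ℝ f) x) x := by
  have hf' : Continuous (fderiv ℝ f) := hf.continuous_fderiv one_ne_zero
  obtain ⟨C, hC⟩ := ((isCompact_closedBall x 1).prod
    (isCompact_Icc (a := (0 : ℝ)) (b := 1))).exists_bound_of_continuousOn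
      (continuous_lineAvg_integrand (v := v) hκ hf').continuousOn
  refine intervalIntegral.hasFDerivAt_integral_of_dominated_of_fderiv_le
    (F := fun x s => κ s • f (x + s • v)) (F' := fun x s => κ s • fderiv ℝ f (x + s • v))
    (bound := fun _ => C) (Metric.closedBall_mem_nhds x one_pos) ?_
    (intervalIntegrable_lineAvg hκ hf.continuous x) ?_ ?_ intervalIntegrable_const ?_
  · refine .of_forall fun y => Continuous.aestronglyMeasurable ?_
    have := hf.continuous
    fun_prop
  · have : SecondCountableTopologyEither ℝ (Pt d →L[ℝ] E) :=
      secondCountableTopologyEither_of_left _ _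
    refine Continuous.aestronglyMeasurable ?_
    fun_prop
  · refine .of_forall fun s hs y hy => hC (y, s) ⟨hy, ?_⟩
    rw [Set.uIoc_of_le zero_le_one] at hs
    exact Set.Ioc_subset_Icc_self hs
  · refine .of_forall fun s _ y _ => ?_
    have h1 : HasFDerivAt f (fderiv ℝ f (y + s • v)) (y + s • v) :=
      (hf.differentiable one_ne_zero _).hasFDerivAt
    exact ((hasFDerivAt_comp_add_right (s • v)).2 h1).const_smul (κ s)

theorem contDiff_lineAvg_nat (hκ : Continuous κ) (n : ℕ) :
    ∀ {E : Type*} [NormedAddCommGroup E] [NormedSpace ℝ E] {f : Pt d → E},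
      ContDiff ℝ n f → ContDiff ℝ n (lineAvg κ v f) := by
  induction n with
  | zero =>
    intro E _ _ f hf
    simp only [Nat.cast_zero, contDiff_zero] at hf ⊢
    exact continuous_lineAvg hκ hf
  | succ n ih =>
    intro E _ _ f hf
    have h1 : ContDiff ℝ 1 f := hf.of_le (by norm_cast; omega)
    have hd := hasFDerivAt_lineAvg (v := v) hκ h1
    push_cast at hf ⊢
    rw [contDiff_succ_iff_fderiv] at hf ⊢
    refine ⟨fun x => (hd x).differentiableAt, by simp, ?_⟩
    rw [funext fun x => (hd x).fderiv]
    exact ih hf.2.2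

theorem contDiff_lineAvg (hκ : Continuous κ) (hf : ContDiff ℝ (⊤ : ℕ∞) f) :
    ContDiff ℝ (⊤ : ℕ∞) (lineAvg κ v f) :=
  contDiff_infty.2 fun n => contDiff_lineAvg_nat hκ n (contDiff_infty.1 hf n)

theorem iteratedFDeriv_lineAvg [CompleteSpace E] (hκ : Continuous κ)
    (hf : ContDiff ℝ (⊤ : ℕ∞) f) (n : ℕ) :
    iteratedFDeriv ℝ n (lineAvg κ v f) = lineAvg κ v (iteratedFDeriv ℝ n f) := by
  induction n with
  | zero =>
    ext1 x
    rw [iteratedFDeriv_zero_eq_comp, iteratedFDeriv_zero_eq_comp]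
    exact clm_lineAvg hκ hf.continuous
      ((continuousMultilinearCurryFin0 ℝ (Pt d) E).symm.toContinuousLinearEquiv :
        E →L[ℝ] (ContinuousMultilinearMap ℝ (fun _ : Fin 0 => Pt d) E)) x
  | succ n ih =>
    ext1 x
    have h1 : ContDiff ℝ 1 (iteratedFDeriv ℝ n f) :=
      hf.iteratedFDeriv_right (m := 1) (by norm_cast; exact le_top)
    rw [iteratedFDeriv_succ_eq_comp_left, iteratedFDeriv_succ_eq_comp_left, Function.comp_apply,
      ih, (hasFDerivAt_lineAvg hκ h1 x).fderiv]
    exact clm_lineAvg hκ (h1.continuous_fderiv one_ne_zero)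
      ((continuousMultilinearCurryLeftEquiv ℝ (fun _ : Fin (n + 1) => Pt d)
        E).symm.toContinuousLinearEquiv :
        _ →L[ℝ] (ContinuousMultilinearMap ℝ (fun _ : Fin (n + 1) => Pt d) E)) x

end LineAvg

section Box

theorem μbox_eq_pi (d : ℕ) :
    μbox d = Measure.pi fun _ => volume.restrict (Set.Ioc (0 : ℝ) 1) := by
  have h : box d = Set.univ.pi fun _ => Set.Icc (0 : ℝ) 1 := by
    rw [box, Set.pi_univ_Icc]; rfl
  simp_rw [μbox, h, volume_pi, Measure.restrict_pi_pi, Measure.restrict_congr_set Ioc_ae_eq_Icc]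

instance isProbabilityMeasure_restrict_Ioc :
    IsProbabilityMeasure (volume.restrict (Set.Ioc (0 : ℝ) 1)) :=
  ⟨by simp⟩

instance isProbabilityMeasure_μbox (d : ℕ) : IsProbabilityMeasure (μbox d) := by
  rw [μbox_eq_pi]
  infer_instance

theorem exists_measurePreserving_of_circle {g : ℝ → ℝ} {ψ : UnitAddCircle → UnitAddCircle}
    (hψ : MeasurePreserving ψ) (h : ∀ x : ℝ, (g x : UnitAddCircle) = ψ x) :
    ∃ φ : ℝ → ℝ, MeasurePreserving φ (volume.restrict (Set.Ioc 0 1))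
      (volume.restrict (Set.Ioc 0 1)) ∧ ∀ x, ∃ m : ℤ, φ x = g x + m := by
  have hσ := (measurePreserving_subtype_coe (μa := (volume : Measure ℝ))
    (measurableSet_Ioc (a := (0 : ℝ)) (b := 0 + 1))).comp
      (AddCircle.measurePreserving_equivIoc (1 : ℝ) (a := 0))
  have hπ := AddCircle.measurePreserving_mk (1 : ℝ) 0
  refine ⟨fun x => (AddCircle.equivIoc 1 0 (ψ x) : ℝ), ?_, fun x => ?_⟩
  · have h01 : (0 : ℝ) + 1 = 1 := zero_add 1
    have := hσ.comp (hψ.comp hπ)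
    convert! this using 3 <;> exact h01.symm
  · have h1 : ((AddCircle.equivIoc 1 0 (ψ x) : ℝ) : UnitAddCircle) = (g x : UnitAddCircle) := by
      rw [h]
      exact (AddCircle.equivIoc (1 : ℝ) 0).symm_apply_apply (ψ x)
    rw [← sub_eq_zero, ← AddCircle.coe_sub, AddCircle.coe_eq_zero_iff] at h1
    obtain ⟨m, hm⟩ := h1
    exact ⟨m, by simp at hm; linarith⟩

variable {d : ℕ} {α E : Type*} [NormedAddCommGroup E] {f : Pt d → E}

theorem ZPer.exists_measurePreserving_μbox {f : Pt d → α} (hf : ZPer f)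
    {g : Fin d → ℝ → ℝ} {ψ : Fin d → UnitAddCircle → UnitAddCircle}
    (hψ : ∀ i, MeasurePreserving (ψ i)) (h : ∀ i, ∀ x : ℝ, (g i x : UnitAddCircle) = ψ i x) :
    ∃ φ : Pt d → Pt d, MeasurePreserving φ (μbox d) (μbox d) ∧
      ∀ x, f (φ x) = f fun i => g i (x i) := by
  choose φ hφ m hm using fun i => exists_measurePreserving_of_circle (hψ i) (h i)
  refine ⟨fun x i => φ i (x i), ?_, fun x => ?_⟩
  · rw [μbox_eq_pi]
    exact measurePreserving_pi _ _ hφ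
  · simp only [hm]
    exact hf _ fun i => m i (x i)

theorem ZPer.exists_measurePreserving_add {f : Pt d → α} (hf : ZPer f) (h : Pt d) :
    ∃ φ : Pt d → Pt d, MeasurePreserving φ (μbox d) (μbox d) ∧
      ∀ x, f (φ x) = f (x + h) :=
  hf.exists_measurePreserving_μbox (g := fun i t => t + h i)
    (ψ := fun i t => t + (h i : UnitAddCircle))
    (fun i => measurePreserving_add_right _ _) (fun i x => by simp)

theorem ZPer.exists_measurePreserving_smul {f : Pt d → α} (hf : ZPer f) {n : ℕ} (hn : n ≠ 0) :
    ∃ φ : Pt d → Pt d, MeasurePreserving φ (μbox d) (μbox d) ∧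
      ∀ x, f (φ x) = f ((n : ℝ) • x) :=
  hf.exists_measurePreserving_μbox (g := fun i t => n * t) (ψ := fun i t => n • t)
    (fun i => by
      simpa using MeasureTheory.Measure.measurePreserving_zsmul (volume : Measure UnitAddCircle)
        (n := (n : ℤ)) (by exact_mod_cast hn)) (fun i x => by simp)

theorem eLpNorm_add_right_of_zPer (hf : Continuous f) (hp : ZPer f) (h : Pt d) (p : ℝ≥0∞) :
    eLpNorm (fun x => f (x + h)) p (μbox d) = eLpNorm f p (μbox d) := by
  obtain ⟨φ, hφ, hφf⟩ := hp.exists_measurePreserving_add h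
  simp_rw [← hφf]
  exact eLpNorm_comp_measurePreserving hf.aestronglyMeasurable hφ

theorem eLpNorm_smul_of_zPer (hf : Continuous f) (hp : ZPer f) {n : ℕ} (hn : n ≠ 0) (p : ℝ≥0∞) :
    eLpNorm (fun x => f ((n : ℝ) • x)) p (μbox d) = eLpNorm f p (μbox d) := by
  obtain ⟨φ, hφ, hφf⟩ := hp.exists_measurePreserving_smul hn
  simp_rw [← hφf]
  exact eLpNorm_comp_measurePreserving hf.aestronglyMeasurable hφ

theorem integral_add_right_of_zPer [NormedSpace ℝ E] (hf : Continuous f) (hp : ZPer f) (h : Pt d) :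
    ∫ x, f (x + h) ∂μbox d = ∫ x, f x ∂μbox d := by
  obtain ⟨φ, hφ, hφf⟩ := hp.exists_measurePreserving_add h
  simp_rw [← hφf]
  rw [← integral_map hφ.measurable.aemeasurable hf.aestronglyMeasurable, hφ.map_eq]

/-- Minkowski's inequality for averages over a probability space. -/
theorem eLpNorm_lintegral_le {X S : Type*} [MeasurableSpace X] [MeasurableSpace S]
    {μ : Measure X} {ν : Measure S} [SFinite μ] [IsProbabilityMeasure ν]
    {F : X × S → ℝ≥0∞} (hF : Measurable F) {p M : ℝ≥0∞} (hp : 1 ≤ p)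
    (hM : ∀ s, eLpNorm (fun x => F (x, s)) p μ ≤ M) :
    eLpNorm (fun x => ∫⁻ s, F (x, s) ∂ν) p μ ≤ M := by
  rcases eq_or_ne p ∞ with rfl | hp'
  · simp only [eLpNorm_exponent_top, eLpNormEssSup] at hM ⊢
    refine essSup_le_of_ae_le _ ?_
    have h1 : ∀ s, ∀ᵐ x ∂μ, F (x, s) ≤ M := fun s =>
      (ENNReal.ae_le_essSup _).mono fun x hx => hx.trans (hM s)
    have h2 : ∀ᵐ x ∂μ, ∀ᵐ s ∂ν, F (x, s) ≤ M :=
      (Measure.ae_ae_comm (p := fun x s => F (x, s) ≤ M) (measurableSet_le hF measurable_const)).2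
        (.of_forall h1)
    filter_upwards [h2] with x hx
    calc ∫⁻ s, F (x, s) ∂ν ≤ ∫⁻ _, M ∂ν := lintegral_mono_ae hx
      _ = M := by simp
  · have hp0 : p ≠ 0 := (one_pos.trans_le hp).ne'
    have hp1 : 0 < p.toReal := ENNReal.toReal_pos hp0 hp'
    have key : ∀ {A : X → ℝ≥0∞}, eLpNorm A p μ ≤ M ↔ ∫⁻ x, A x ^ p.toReal ∂μ ≤ M ^ p.toReal := by
      intro A
      rw [eLpNorm_eq_lintegral_rpow_enorm_toReal hp0 hp']
      simp only [enorm_eq_self, one_div]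
      rw [ENNReal.rpow_inv_le_iff hp1]
    rw [key]
    calc ∫⁻ x, (∫⁻ s, F (x, s) ∂ν) ^ p.toReal ∂μ
        ≤ ∫⁻ x, ∫⁻ s, F (x, s) ^ p.toReal ∂ν ∂μ := by
          refine lintegral_mono fun x => ?_
          have hm : AEStronglyMeasurable (fun s => F (x, s)) ν :=
            (hF.comp measurable_prodMk_left).aestronglyMeasurable
          have := eLpNorm_le_eLpNorm_of_exponent_le hp hm
          rw [eLpNorm_one_eq_lintegral_enorm, eLpNorm_eq_lintegral_rpow_enorm_toReal hp0 hp',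
            one_div, ENNReal.le_rpow_inv_iff hp1] at this
          simpa only [enorm_eq_self] using this
      _ = ∫⁻ s, ∫⁻ x, F (x, s) ^ p.toReal ∂μ ∂ν :=
          lintegral_lintegral_swap (hF.pow_const _).aemeasurable
      _ ≤ ∫⁻ _, M ^ p.toReal ∂ν := lintegral_mono fun s => key.1 (hM s)
      _ = M ^ p.toReal := by simp

end Box

section LineAvgPeriodic

variable {d : ℕ} {E : Type*} [NormedAddCommGroup E] [NormedSpace ℝ E]
  {κ : ℝ → ℝ} {v : Pt d} {f : Pt d → E}

theorem ZPer.lineAvg (hf : ZPer f) : ZPer (lineAvg κ v f) :=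
  fun x m => lineAvg_add_of_forall (fun y => hf y m) x

theorem integral_lineAvg [CompleteSpace E] (hκ : Continuous κ) (hf : Continuous f) (hp : ZPer f) :
    ∫ x, lineAvg κ v f x ∂μbox d = (∫ s in (0 : ℝ)..1, κ s) • ∫ x, f x ∂μbox d := by
  have hint : Integrable (fun q : Pt d × ℝ => κ q.2 • f (q.1 + q.2 • v))
      ((μbox d).prod (volume.restrict (Set.Ioc 0 1))) := by
    rw [μbox, Measure.prod_restrict]
    refine IntegrableOn.mono_set (t := box d ×ˢ Set.Icc 0 1) ?_
      (Set.prod_mono subset_rfl Set.Ioc_subset_Icc_self)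
    exact (continuous_lineAvg_integrand hκ hf).continuousOn.integrableOn_compact
      (isCompact_Icc.prod isCompact_Icc)
  simp only [NonNewtonian.lineAvg, intervalIntegral.integral_of_le zero_le_one]
  rw [integral_integral_swap hint, ← integral_smul_const]
  congr 1 with s
  rw [integral_smul, integral_add_right_of_zPer hf hp]

theorem eLpNorm_lineAvg_le (hκ : ∀ s ∈ Set.Ioc (0 : ℝ) 1, |κ s| ≤ 1) (hf : Continuous f)
    (hp : ZPer f) {p : ℝ≥0∞} (hp1 : 1 ≤ p) :
    eLpNorm (lineAvg κ v f) p (μbox d) ≤ eLpNorm f p (μbox d) := by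
  have hF : Measurable fun q : Pt d × ℝ => ‖f (q.1 + q.2 • v)‖ₑ := by
    refine Continuous.measurable ?_
    fun_prop
  refine le_trans (eLpNorm_mono_enorm fun x => ?_)
    (eLpNorm_lintegral_le (ν := volume.restrict (Set.Ioc (0 : ℝ) 1)) hF hp1 fun s => ?_)
  · rw [NonNewtonian.lineAvg, intervalIntegral.integral_of_le zero_le_one, enorm_eq_self]
    refine (enorm_integral_le_lintegral_enorm _).trans ?_
    refine setLIntegral_mono' measurableSet_Ioc fun s hs => ?_
    rw [enorm_smul]
    refine mul_le_of_le_one_left' ?_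
    rw [← ofReal_norm, ENNReal.ofReal_le_one]
    exact hκ s hs
  · rw [eLpNorm_enorm]
    exact (eLpNorm_add_right_of_zPer hf hp (s • v) p).le

theorem lineAvg_one_add_smul (hv : ∀ x, f (x + v) = f x) (x : Pt d) (t : ℝ) :
    lineAvg (fun _ => 1) v f (x + t • v) = lineAvg (fun _ => 1) v f x := by
  have hper : Function.Periodic (fun s : ℝ => f (x + s • v)) 1 := fun s => by
    simp only [add_smul, one_smul, ← add_assoc, hv]
  have h := hper.intervalIntegral_add_eq t 0
  have h2 := intervalIntegral.integral_comp_add_left (a := 0) (b := 1) (fun s => f (x + s • v)) t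
  rw [zero_add] at h
  rw [add_zero, h] at h2
  simpa only [lineAvg, one_smul, add_smul, ← add_assoc] using h2

theorem fderiv_apply_eq_zero_of_invariant (hf : ∀ x (t : ℝ), f (x + t • v) = f x) (x : Pt d) :
    fderiv ℝ f x v = 0 := by
  by_cases h : DifferentiableAt ℝ f x
  · rw [← h.lineDeriv_eq_fderiv, lineDeriv]
    simp [hf]
  · simp [fderiv_zero_of_not_differentiableAt h]

theorem fderiv_lineAvg_sub_half [CompleteSpace E] (hf : ContDiff ℝ 1 f)
    (hv : ∀ x, f (x + v) = f x) (x : Pt d) :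
    fderiv ℝ (lineAvg (fun s => s - 1 / 2) v f) x v = f x - lineAvg (fun _ => 1) v f x := by
  have hκ : Continuous fun s : ℝ => s - 1 / 2 := by fun_prop
  have hf' : Continuous (fderiv ℝ f) := hf.continuous_fderiv one_ne_zero
  rw [(hasFDerivAt_lineAvg hκ hf x).fderiv]
  have h := clm_lineAvg (v := v) hκ hf' (ContinuousLinearMap.apply ℝ E v) x
  simp only [ContinuousLinearMap.apply_apply] at h
  rw [h]
  have hd : ∀ s : ℝ, HasDerivAt (fun s : ℝ => f (x + s • v)) (fderiv ℝ f (x + s • v) v) s := by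
    intro s
    have h1 := (hf.differentiable one_ne_zero (x + s • v)).hasFDerivAt
    have h2 : HasDerivAt (fun s : ℝ => x + s • v) v s := by
      simpa using ((hasDerivAt_id s).smul_const v).const_add x
    exact h1.comp_hasDerivAt s h2
  have h3 := intervalIntegral.integral_smul_deriv_eq_deriv_smul (a := (0 : ℝ)) (b := 1)
    (u := fun s : ℝ => s - 1 / 2) (u' := fun _ => 1)
    (fun s _ => (hasDerivAt_id s).sub_const _) (fun s _ => hd s)
    intervalIntegrable_const (Continuous.intervalIntegrable (by fun_prop) _ _)
  simp only [lineAvg, h3, one_smul, zero_smul, add_zero, hv]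
  norm_num
  module

theorem integral_affine_smul_periodic {h : ℝ → E} (hh : Continuous h) (hp : Function.Periodic h 1)
    (a c : ℝ) (n : ℕ) :
    ∫ t in (0 : ℝ)..n, (a * t + c) • h t = (a * n) • (∫ t in (0 : ℝ)..1, t • h t) +
      (a * (n * (n - 1) / 2) + c * n) • ∫ t in (0 : ℝ)..1, h t := by
  induction n with
  | zero => simp
  | succ n ih =>
    have hi : ∀ x y : ℝ, IntervalIntegrable (fun t => (a * t + c) • h t) volume x y := fun x y =>
      Continuous.intervalIntegrable (by fun_prop) _ _
    have h1 : ∫ t in (n : ℝ)..(n + 1), (a * t + c) • h t =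
        a • (∫ t in (0 : ℝ)..1, t • h t) + (a * n + c) • ∫ t in (0 : ℝ)..1, h t := by
      have h2 := intervalIntegral.integral_comp_add_right (a := 0) (b := 1)
        (fun t => (a * t + c) • h t) (n : ℝ)
      rw [zero_add, add_comm 1 (n : ℝ)] at h2
      have hpn : ∀ t, h (t + n) = h t := fun t => by simpa using hp.nat_mul n t
      rw [← h2, ← intervalIntegral.integral_smul, ← intervalIntegral.integral_smul,
        ← intervalIntegral.integral_add]
      · refine intervalIntegral.integral_congr fun t _ => ?_
        simp only [hpn]
        module
      · exact Continuous.intervalIntegrable (by fun_prop) _ _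
      · exact Continuous.intervalIntegrable (by fun_prop) _ _
    push_cast
    rw [← intervalIntegral.integral_add_adjacent_intervals (hi 0 n) (hi n (n + 1)), ih, h1]
    module

theorem lineAvg_one_comp_smul (hf : Continuous f) (hv : ∀ x, f (x + v) = f x) {n : ℕ}
    (hn : n ≠ 0) :
    lineAvg (fun _ => 1) v (fun y => f ((n : ℝ) • y)) =
      fun x => lineAvg (fun _ => 1) v f ((n : ℝ) • x) := by
  ext1 x
  have hn' : (n : ℝ) ≠ 0 := by exact_mod_cast hn
  have hper : Function.Periodic (fun s : ℝ => f ((n : ℝ) • x + s • v)) 1 := fun s => by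
    simp only [add_smul, one_smul, ← add_assoc, hv]
  have h := integral_affine_smul_periodic (by fun_prop) hper 0 1 n
  have h2 := intervalIntegral.integral_comp_mul_left (a := 0) (b := 1)
    (fun s : ℝ => f ((n : ℝ) • x + s • v)) hn'
  simp only [zero_mul, zero_add, one_smul, zero_smul, one_mul, mul_zero, mul_one] at h h2
  simp only [lineAvg, one_smul, smul_add, smul_smul]
  rw [h2, h, smul_smul, inv_mul_cancel₀ hn', one_smul]

theorem lineAvg_sub_half_comp_smul (hf : Continuous f) (hv : ∀ x, f (x + v) = f x) {n : ℕ}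
    (hn : n ≠ 0) :
    lineAvg (fun s => s - 1 / 2) v (fun y => f ((n : ℝ) • y)) =
      fun x => (n : ℝ)⁻¹ • lineAvg (fun s => s - 1 / 2) v f ((n : ℝ) • x) := by
  ext1 x
  have hn' : (n : ℝ) ≠ 0 := by exact_mod_cast hn
  set g : ℝ → E := fun s => f ((n : ℝ) • x + s • v) with hg
  have hgc : Continuous g := by fun_prop
  have hper : Function.Periodic g 1 := fun s => by
    simp only [hg, add_smul, one_smul, ← add_assoc, hv]
  have h := integral_affine_smul_periodic hgc hper (n : ℝ)⁻¹ (-1 / 2) n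
  have h2 := intervalIntegral.integral_comp_mul_left (a := 0) (b := 1)
    (fun s : ℝ => ((n : ℝ)⁻¹ * s + (-1 / 2)) • g s) hn'
  have h3 : ∀ s : ℝ, (n : ℝ)⁻¹ * (n * s) + (-1 / 2) = s - 1 / 2 := fun s => by
    field_simp; ring
  simp only [h3, mul_zero, mul_one] at h2
  have h4 := integral_affine_smul_periodic hgc hper 1 (-1 / 2) 1
  simp only [Nat.cast_one] at h4
  simp only [lineAvg, smul_add, smul_smul]
  change (∫ s in (0 : ℝ)..1, (s - 1 / 2) • g (n * s)) = _ • ∫ s in (0 : ℝ)..1, (s - 1 / 2) • g s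
  have h5 : ∫ s in (0 : ℝ)..1, (s - 1 / 2) • g s =
      (∫ s in (0 : ℝ)..1, s • g s) - (1 / 2 : ℝ) • ∫ s in (0 : ℝ)..1, g s := by
    convert! h4 using 1
    · refine intervalIntegral.integral_congr fun s _ => ?_
      module
    · module
  have e1 : (n : ℝ)⁻¹ * n = 1 := inv_mul_cancel₀ hn'
  have e2 : (n : ℝ)⁻¹ * (n * (n - 1) / 2) + -1 / 2 * n = -(1 / 2) := by
    field_simp
    ring
  rw [h2, h, h5, e1, e2]
  module

end LineAvgPeriodic

section AveragingOp

variable {d : ℕ} {E : Type*} [NormedAddCommGroup E] [NormedSpace ℝ E]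

/-- Smooth `ℤ^d`-periodic functions. -/
structure SmoothPer (f : Pt d → E) : Prop where
  contDiff : ContDiff ℝ (⊤ : ℕ∞) f
  zPer : ZPer f

/-- Linear operators built from weighted line averages: they commute with translations, contract
every `L^p` norm of every derivative, and are homogeneous, with factor `c n`, under `x ↦ n • x`. -/
structure AveragingOp (c : ℕ → ℝ) (A : (Pt d → E) → Pt d → E) : Prop where
  smoothPer : ∀ {f}, SmoothPer f → SmoothPer (A f)
  map_add : ∀ {f g}, SmoothPer f → SmoothPer g → A (f + g) = A f + A g
  map_smul : ∀ (r : ℝ) f, A (r • f) = r • A f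
  invariant : ∀ {f h}, (∀ x, f (x + h) = f x) → ∀ x, A f (x + h) = A f x
  eLpNorm_le : ∀ {f}, SmoothPer f → ∀ (n : ℕ) {p : ℝ≥0∞}, 1 ≤ p →
    eLpNorm (iteratedFDeriv ℝ n (A f)) p (μbox d) ≤ eLpNorm (iteratedFDeriv ℝ n f) p (μbox d)
  comp_smul : ∀ {f}, SmoothPer f → ∀ {n : ℕ}, n ≠ 0 →
    A (fun x => f ((n : ℝ) • x)) = fun x => c n • A f ((n : ℝ) • x)

theorem ZPer.iteratedFDeriv {f : Pt d → E} (hf : ZPer f) (n : ℕ) :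
    ZPer (iteratedFDeriv ℝ n f) := fun x m => by
  rw [← iteratedFDeriv_comp_add_right, funext fun y => hf y m]

theorem SmoothPer.continuous_iteratedFDeriv {f : Pt d → E} (hf : SmoothPer f) (n : ℕ) :
    Continuous (iteratedFDeriv ℝ n f) :=
  hf.contDiff.continuous_iteratedFDeriv (by exact_mod_cast le_top)

theorem AveragingOp.comp {c c' : ℕ → ℝ} {A B : (Pt d → E) → Pt d → E} (hA : AveragingOp c A)
    (hB : AveragingOp c' B) : AveragingOp (c' * c) fun f => A (B f) where
  smoothPer hf := hA.smoothPer (hB.smoothPer hf)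
  map_add hf hg := by rw [hB.map_add hf hg, hA.map_add (hB.smoothPer hf) (hB.smoothPer hg)]
  map_smul r f := by rw [hB.map_smul, hA.map_smul]
  invariant hf := hA.invariant (hB.invariant hf)
  eLpNorm_le hf n _ hp := (hA.eLpNorm_le (hB.smoothPer hf) n hp).trans (hB.eLpNorm_le hf n hp)
  comp_smul {f} hf n hn := by
    have h := hA.map_smul (c' n) fun x => B f ((n : ℝ) • x)
    rw [hA.comp_smul (hB.smoothPer hf) hn] at h
    rw [hB.comp_smul hf hn]
    refine h.trans (funext fun x => ?_)
    simp [mul_smul]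

theorem averagingOp_id : AveragingOp (1 : ℕ → ℝ) fun f : Pt d → E => f where
  smoothPer hf := hf
  map_add _ _ := rfl
  map_smul _ _ := rfl
  invariant hf := hf
  eLpNorm_le _ _ _ _ := le_rfl
  comp_smul _ _ _ := by simp

theorem averagingOp_lineAvg [CompleteSpace E] {κ : ℝ → ℝ} {v : Pt d} {c : ℕ → ℝ}
    (hκ : Continuous κ) (hκ1 : ∀ s ∈ Set.Ioc (0 : ℝ) 1, |κ s| ≤ 1)
    (hc : ∀ {f : Pt d → E}, SmoothPer f → ∀ {n : ℕ}, n ≠ 0 →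
      lineAvg κ v (fun x => f ((n : ℝ) • x)) = fun x => c n • lineAvg κ v f ((n : ℝ) • x)) :
    AveragingOp c (lineAvg (E := E) κ v) where
  smoothPer hf := ⟨contDiff_lineAvg hκ hf.contDiff, hf.zPer.lineAvg⟩
  map_add hf hg := lineAvg_add hκ hf.contDiff.continuous hg.contDiff.continuous
  map_smul r _ := lineAvg_smul r
  invariant := lineAvg_add_of_forall
  eLpNorm_le hf n _ hp := by
    rw [iteratedFDeriv_lineAvg hκ hf.contDiff]
    exact eLpNorm_lineAvg_le hκ1 (hf.continuous_iteratedFDeriv n) (hf.zPer.iteratedFDeriv n) hp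
  comp_smul := hc

/-- The `n`-th coordinate vector, which is `0` for `d ≤ n`. -/
def coordVec (d n : ℕ) : Pt d := fun i => if (i : ℕ) = n then 1 else 0

theorem coordVec_eq_single (j : Fin d) : coordVec d j = Pi.single j 1 := by
  ext i
  simp [coordVec, Pi.single_apply, Fin.ext_iff]

theorem ZPer.add_coordVec {α : Type*} {f : Pt d → α} (hf : ZPer f) (n : ℕ) (x : Pt d) :
    f (x + coordVec d n) = f x := by
  convert! hf x fun i => if (i : ℕ) = n then 1 else 0 using 3
  simp only [Int.cast_ite, Int.cast_one, Int.cast_zero]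
  rfl

/-- The average in the `n`-th coordinate. -/
def coordAvg (n : ℕ) (f : Pt d → E) : Pt d → E := lineAvg (fun _ => 1) (coordVec d n) f

/-- The periodic zero-mean primitive, in the `n`-th coordinate, of `f - coordAvg n f`. -/
def coordPrim (n : ℕ) (f : Pt d → E) : Pt d → E := lineAvg (fun s => s - 1 / 2) (coordVec d n) f

/-- The average in the first `n` coordinates. -/
def coordAvgLT : ℕ → (Pt d → E) → Pt d → E
  | 0, f => f
  | n + 1, f => coordAvg n (coordAvgLT n f)

theorem averagingOp_coordAvg [CompleteSpace E] (n : ℕ) :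
    AveragingOp 1 (coordAvg (d := d) (E := E) n) :=
  averagingOp_lineAvg continuous_const (by simp) fun hf _ hn => by
    simpa using lineAvg_one_comp_smul hf.contDiff.continuous (hf.zPer.add_coordVec n) hn

theorem averagingOp_coordPrim [CompleteSpace E] (n : ℕ) :
    AveragingOp (fun n => (n : ℝ)⁻¹) (coordPrim (d := d) (E := E) n) :=
  averagingOp_lineAvg (by fun_prop) (fun s hs => abs_le.2 ⟨by linarith [hs.1], by linarith [hs.2]⟩)
    fun hf _ hn => lineAvg_sub_half_comp_smul hf.contDiff.continuous (hf.zPer.add_coordVec n) hn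

theorem averagingOp_coordAvgLT [CompleteSpace E] (n : ℕ) :
    AveragingOp 1 (coordAvgLT (d := d) (E := E) n) := by
  induction n with
  | zero => exact averagingOp_id
  | succ n ih => exact mul_one (1 : ℕ → ℝ) ▸ (averagingOp_coordAvg n).comp ih

theorem coordAvg_add_smul {f : Pt d → E} (hf : ZPer f) (n : ℕ) (x : Pt d) (t : ℝ) :
    coordAvg n f (x + t • coordVec d n) = coordAvg n f x :=
  lineAvg_one_add_smul (hf.add_coordVec n) x t

theorem AveragingOp.fderiv_coordAvg_apply {c : ℕ → ℝ} {A : (Pt d → E) → Pt d → E}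
    (hA : AveragingOp c A) {f : Pt d → E} (hf : ZPer f) (n : ℕ) (x : Pt d) :
    fderiv ℝ (A (coordAvg n f)) x (coordVec d n) = 0 :=
  fderiv_apply_eq_zero_of_invariant
    (fun x t => hA.invariant (fun y => coordAvg_add_smul hf n y t) x) x

variable [CompleteSpace E]

theorem fderiv_coordPrim_apply {f : Pt d → E} (hf : SmoothPer f) (n : ℕ) (x : Pt d) :
    fderiv ℝ (coordPrim n f) x (coordVec d n) = f x - coordAvg n f x :=
  fderiv_lineAvg_sub_half (hf.contDiff.of_le (by exact_mod_cast le_top))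
    (hf.zPer.add_coordVec n) x

theorem integral_coordPrim {f : Pt d → E} (hf : SmoothPer f) (n : ℕ) :
    ∫ x, coordPrim n f x ∂μbox d = 0 := by
  have h : ∫ s in (0 : ℝ)..1, (s - 1 / 2) = 0 := by
    rw [intervalIntegral.integral_sub (by simp) (by simp)]
    norm_num
  rw [coordPrim, integral_lineAvg (by fun_prop) hf.contDiff.continuous hf.zPer, h, zero_smul]

theorem integral_coordAvg {f : Pt d → E} (hf : SmoothPer f) (n : ℕ) :
    ∫ x, coordAvg n f x ∂μbox d = ∫ x, f x ∂μbox d := by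
  rw [coordAvg, integral_lineAvg (by fun_prop) hf.contDiff.continuous hf.zPer]
  simp

theorem integral_coordAvgLT {f : Pt d → E} (hf : SmoothPer f) (n : ℕ) :
    ∫ x, coordAvgLT n f x ∂μbox d = ∫ x, f x ∂μbox d := by
  induction n with
  | zero => rfl
  | succ n ih => rw [coordAvgLT, integral_coordAvg ((averagingOp_coordAvgLT n).smoothPer hf), ih]

theorem coordAvgLT_add_smul {f : Pt d → E} (hf : SmoothPer f) {n k : ℕ} (hk : k < n) (x : Pt d)
    (t : ℝ) : coordAvgLT n f (x + t • coordVec d k) = coordAvgLT n f x := by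
  induction n generalizing x with
  | zero => omega
  | succ n ih =>
    rcases Nat.lt_succ_iff_lt_or_eq.1 hk with h | rfl
    · exact (averagingOp_coordAvg n).invariant (ih h) x
    · exact coordAvg_add_smul ((averagingOp_coordAvgLT k).smoothPer hf).zPer k x t

theorem coordAvgLT_eq_zero {f : Pt d → E} (hf : SmoothPer f) (h0 : ∫ x, f x ∂μbox d = 0)
    (x : Pt d) : coordAvgLT d f x = 0 := by
  have hs := (averagingOp_coordAvgLT d).smoothPer hf
  have hd : ∀ y, fderiv ℝ (coordAvgLT d f) y = 0 := fun y => by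
    refine ContinuousLinearMap.coe_injective (LinearMap.pi_ext' fun j => LinearMap.ext_ring ?_)
    simpa [coordVec_eq_single] using
      fderiv_apply_eq_zero_of_invariant (coordAvgLT_add_smul hf j.isLt) y
  have hc : ∀ y, coordAvgLT d f y = coordAvgLT d f x := fun y =>
    is_const_of_fderiv_eq_zero (hs.contDiff.differentiable (by simp)) hd y x
  have h := integral_coordAvgLT hf d
  simpa only [hc, integral_const, probReal_univ, one_smul, h0] using h

end AveragingOp

section Antidivergence

variable {d : ℕ}

theorem eLpNorm_iteratedFDeriv_pi_le {ι F : Type*} [Fintype ι] [NormedAddCommGroup F]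
    [NormedSpace ℝ F] {f : Pt d → ι → F} (hf : ContDiff ℝ (⊤ : ℕ∞) f) (n : ℕ) {p : ℝ≥0∞}
    (hp : 1 ≤ p) :
    eLpNorm (iteratedFDeriv ℝ n f) p (μbox d) ≤
      ∑ i, eLpNorm (iteratedFDeriv ℝ n fun x => f x i) p (μbox d) := by
  have hi : ∀ i, ContDiff ℝ (⊤ : ℕ∞) fun x => f x i := contDiff_pi.1 hf
  have hc : ∀ i, Continuous (iteratedFDeriv ℝ n fun x => f x i) := fun i =>
    (hi i).continuous_iteratedFDeriv (by exact_mod_cast le_top)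
  have hsum := eLpNorm_sum_le (μ := μbox d) (s := Finset.univ)
    (f := fun i x => ‖iteratedFDeriv ℝ n (fun y => f y i) x‖)
    (fun i _ => (hc i).norm.aestronglyMeasurable) hp
  simp only [eLpNorm_norm] at hsum
  refine le_trans (eLpNorm_mono_real fun x => ?_) hsum
  simp only [Finset.sum_apply]
  refine ContinuousMultilinearMap.opNorm_le_bound (by positivity) fun m => ?_
  refine (pi_norm_le_iff_of_nonneg (by positivity)).2 fun i => ?_
  have h := (ContinuousLinearMap.proj (R := ℝ) (φ := fun _ : ι => F) i).iteratedFDeriv_comp_left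
    (hf.contDiffAt (x := x)) (i := n) (by exact_mod_cast le_top)
  have h' : iteratedFDeriv ℝ n f x m i = iteratedFDeriv ℝ n (fun y => f y i) x m :=
    (congrArg (fun L => L m) h).symm
  rw [h']
  refine (ContinuousMultilinearMap.le_opNorm _ _).trans ?_
  gcongr
  exact Finset.single_le_sum (f := fun i => ‖iteratedFDeriv ℝ n (fun y => f y i) x‖)
    (fun _ _ => norm_nonneg _) (Finset.mem_univ i)

theorem eLpNorm_iteratedFDeriv_add_le {F : Type*} [NormedAddCommGroup F] [NormedSpace ℝ F]
    {f g : Pt d → F} (hf : ContDiff ℝ (⊤ : ℕ∞) f) (hg : ContDiff ℝ (⊤ : ℕ∞) g) (n : ℕ) {p : ℝ≥0∞}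
    (hp : 1 ≤ p) :
    eLpNorm (iteratedFDeriv ℝ n fun x => f x + g x) p (μbox d) ≤
      eLpNorm (iteratedFDeriv ℝ n f) p (μbox d) + eLpNorm (iteratedFDeriv ℝ n g) p (μbox d) := by
  have hf' : ContDiff ℝ n f := contDiff_infty.1 hf n
  have hg' : ContDiff ℝ n g := contDiff_infty.1 hg n
  have cf : Continuous (iteratedFDeriv ℝ n f) := hf'.continuous_iteratedFDeriv le_rfl
  have cg : Continuous (iteratedFDeriv ℝ n g) := hg'.continuous_iteratedFDeriv le_rfl
  refine le_trans (eLpNorm_mono_real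
    (g := (fun x => ‖iteratedFDeriv ℝ n f x‖) + fun x => ‖iteratedFDeriv ℝ n g x‖) fun x => ?_)
    ((eLpNorm_add_le cf.norm.aestronglyMeasurable cg.norm.aestronglyMeasurable hp).trans ?_)
  · rw [fun_iteratedFDeriv_add_apply hf'.contDiffAt hg'.contDiffAt]
    exact norm_add_le _ _
  · rw [eLpNorm_norm, eLpNorm_norm]

theorem eLpNorm_iteratedFDeriv_clm_comp_le {E F : Type*} [NormedAddCommGroup E] [NormedSpace ℝ E]
    [NormedAddCommGroup F] [NormedSpace ℝ F] {L : E →L[ℝ] F} (hL : ‖L‖ ≤ 1) {f : Pt d → E}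
    (hf : ContDiff ℝ (⊤ : ℕ∞) f) (n : ℕ) (p : ℝ≥0∞) :
    eLpNorm (iteratedFDeriv ℝ n fun x => L (f x)) p (μbox d) ≤
      eLpNorm (iteratedFDeriv ℝ n f) p (μbox d) := by
  refine eLpNorm_mono fun x => ?_
  refine (L.norm_iteratedFDeriv_comp_left hf.contDiffAt (by exact_mod_cast le_top)).trans ?_
  exact mul_le_of_le_one_left (norm_nonneg _) hL

theorem norm_proj_le_one (i : Fin d) :
    ‖(ContinuousLinearMap.proj i : Vec d →L[ℝ] ℝ)‖ ≤ 1 :=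
  ContinuousLinearMap.opNorm_le_bound _ zero_le_one fun x => by simpa using norm_le_pi_norm x i

/-- The operator whose `i`-th component, placed in the entries `(i, j)` and `(j, i)`, inverts the
divergence on the part of the `i`-th component that does not depend on the `i`-th coordinate. -/
def offDiagPrim (i j : ℕ) (u : Pt d → Vec d) : Pt d → Vec d :=
  coordPrim j (coordAvgLT j (coordAvg i u))

/-- The symmetric antidivergence. -/
def antidiv (u : Pt d → Vec d) (x : Pt d) : Mat d := fun i j =>
  (if i = j then (1 : ℝ) else 0) * coordPrim i u x i + offDiagPrim i j u x i + offDiagPrim j i u x j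

theorem averagingOp_offDiagPrim (i j : ℕ) :
    AveragingOp (fun n => (n : ℝ)⁻¹) (offDiagPrim (d := d) i j) := by
  have h := (averagingOp_coordPrim (d := d) (E := Vec d) j).comp
    ((averagingOp_coordAvgLT j).comp (averagingOp_coordAvg i))
  simp only [mul_one, one_mul] at h
  exact h

variable {u v : Pt d → Vec d}

theorem AdmissibleVec.smoothPer (hu : AdmissibleVec d u) : SmoothPer u := ⟨hu.1, hu.2.1⟩

theorem AdmissibleVec.integral_eq_zero (hu : AdmissibleVec d u) : ∫ x, u x ∂μbox d = 0 := by
  ext i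
  rw [eval_integral]
  · exact hu.2.2 i
  · intro i
    exact (continuous_pi_iff.1 hu.1.continuous i).continuousOn.integrableOn_compact isCompact_Icc

theorem SmoothPer.integrable {E : Type*} [NormedAddCommGroup E] [NormedSpace ℝ E] {f : Pt d → E}
    (hf : SmoothPer f) : Integrable f (μbox d) :=
  hf.contDiff.continuous.continuousOn.integrableOn_compact isCompact_Icc

theorem SmoothPer.contDiff_apply (hu : SmoothPer u) (i : Fin d) :
    ContDiff ℝ (⊤ : ℕ∞) fun x => u x i :=
  contDiff_pi.1 hu.contDiff i

theorem SmoothPer.antidiv (hu : SmoothPer u) : SmoothPer (antidiv u) where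
  contDiff := contDiff_pi.2 fun i => contDiff_pi.2 fun j =>
    ((contDiff_const.mul (((averagingOp_coordPrim i).smoothPer hu).contDiff_apply i)).add
      (((averagingOp_offDiagPrim i j).smoothPer hu).contDiff_apply i)).add
      (((averagingOp_offDiagPrim j i).smoothPer hu).contDiff_apply j)
  zPer x m := by
    ext i j
    simp only [NonNewtonian.antidiv, ((averagingOp_coordPrim i).smoothPer hu).zPer x m,
      ((averagingOp_offDiagPrim i j).smoothPer hu).zPer x m,
      ((averagingOp_offDiagPrim j i).smoothPer hu).zPer x m]

theorem integral_antidiv (hu : SmoothPer u) (i j : Fin d) :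
    ∫ x, antidiv u x i j ∂μbox d = 0 := by
  have hi : ∀ {f : Pt d → Vec d}, SmoothPer f → ∀ i, Integrable (fun x => f x i) (μbox d) :=
    fun hf i => hf.integrable.eval i
  have h : ∀ (f : Pt d → Vec d), SmoothPer f → ∀ (i : Fin d) (n : ℕ),
      ∫ x, coordPrim n f x i ∂μbox d = 0 := fun f hf i n => by
    rw [← eval_integral (fun i => hi ((averagingOp_coordPrim n).smoothPer hf) i),
      integral_coordPrim hf]
    rfl
  have h' : ∀ i j k, ∫ x, offDiagPrim i j u x k ∂μbox d = 0 := fun i j k =>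
    h _ ((averagingOp_coordAvgLT j).smoothPer ((averagingOp_coordAvg i).smoothPer hu)) k j
  have i1 := hi ((averagingOp_coordPrim i).smoothPer hu) i
  have i2 := hi ((averagingOp_offDiagPrim i j).smoothPer hu) i
  have i3 := hi ((averagingOp_offDiagPrim j i).smoothPer hu) j
  have i12 : Integrable (fun x => (if i = j then (1 : ℝ) else 0) * coordPrim i u x i +
      offDiagPrim i j u x i) (μbox d) := (i1.const_mul _).add i2
  simp only [antidiv]
  rw [integral_add i12 i3, integral_add (i1.const_mul _) i2,
    integral_const_mul, h u hu, h', h']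
  simp

theorem antidiv_symm (u : Pt d → Vec d) (x : Pt d) (i j : Fin d) :
    antidiv u x i j = antidiv u x j i := by
  rcases eq_or_ne i j with rfl | h
  · rfl
  · simp [antidiv, h, h.symm, add_comm]

theorem SmoothPer.hasFDerivAt_apply (hu : SmoothPer u) (x : Pt d) (i : Fin d) :
    HasFDerivAt (fun y => u y i) ((ContinuousLinearMap.proj i).comp (fderiv ℝ u x)) x :=
  hasFDerivAt_pi'.1 (hu.contDiff.differentiable (by simp) x).hasFDerivAt i

theorem divMat_antidiv (hu : AdmissibleVec d u) (x : Pt d) : divMat (antidiv u) x = u x := by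
  have hs := hu.smoothPer
  ext i
  have hg : SmoothPer (coordAvg i u) := (averagingOp_coordAvg i).smoothPer hs
  have hP : ∀ n, SmoothPer (coordAvgLT n (coordAvg i u)) := fun n =>
    (averagingOp_coordAvgLT n).smoothPer hg
  have hg0 : ∫ x, coordAvg i u x ∂μbox d = 0 := by
    rw [integral_coordAvg hs, hu.integral_eq_zero]
  have hterm : ∀ j : Fin d, fderiv ℝ (fun y => antidiv u y i j) x (Pi.single j 1) =
      (if i = j then u x i - coordAvg i u x i else 0) +
        (coordAvgLT j (coordAvg i u) x i - coordAvgLT (j + 1) (coordAvg i u) x i) := fun j => by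
    have h1 := ((averagingOp_coordPrim i).smoothPer hs).hasFDerivAt_apply x i
    have h2 := ((averagingOp_offDiagPrim i j).smoothPer hs).hasFDerivAt_apply x i
    have h3 := ((averagingOp_offDiagPrim j i).smoothPer hs).hasFDerivAt_apply x j
    have e2 := fderiv_coordPrim_apply (hP j) j x
    have e3 := ((averagingOp_coordPrim (d := d) (E := Vec d) i).comp
      (averagingOp_coordAvgLT i)).fderiv_coordAvg_apply hs.zPer j x
    have e := (((h1.const_mul (if i = j then (1 : ℝ) else 0)).add h2).add h3).fderiv
    have e' : fderiv ℝ (fun y => antidiv u y i j) x = _ := e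
    rw [e', ← coordVec_eq_single]
    have e2' : fderiv ℝ (offDiagPrim i j u) x (coordVec d j) = _ := e2
    have e3' : fderiv ℝ (offDiagPrim j i u) x (coordVec d j) = 0 := e3
    simp only [add_apply, smul_apply, ContinuousLinearMap.comp_apply,
      ContinuousLinearMap.proj_apply, e2', e3']
    rcases eq_or_ne i j with rfl | h
    · rw [fderiv_coordPrim_apply hs]
      simp [coordAvgLT]
    · simp [h, coordAvgLT]
  have hsum : ∑ j : Fin d, (coordAvgLT j (coordAvg i u) x i -
      coordAvgLT (j + 1) (coordAvg i u) x i) = coordAvg i u x i := by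
    rw [Fin.sum_univ_eq_sum_range (fun j => coordAvgLT j (coordAvg i u) x i -
      coordAvgLT (j + 1) (coordAvg i u) x i), Finset.sum_range_sub',
      coordAvgLT_eq_zero hg hg0]
    simp [coordAvgLT]
  simp only [divMat, hterm]
  rw [Finset.sum_add_distrib, hsum]
  simp

theorem antidiv_add (hu : SmoothPer u) (hv : SmoothPer v) :
    antidiv (u + v) = antidiv u + antidiv v := by
  ext x i j
  simp only [antidiv, (averagingOp_coordPrim _).map_add hu hv,
    (averagingOp_offDiagPrim _ _).map_add hu hv, Pi.add_apply]
  ring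

theorem antidiv_smul (c : ℝ) (u : Pt d → Vec d) : antidiv (c • u) = c • antidiv u := by
  ext x i j
  simp only [antidiv, (averagingOp_coordPrim _).map_smul,
    (averagingOp_offDiagPrim _ _).map_smul, Pi.smul_apply, smul_eq_mul]
  ring

theorem antidiv_comp_smul (hu : SmoothPer u) {n : ℕ} (hn : n ≠ 0) :
    antidiv (fun x => u ((n : ℝ) • x)) = (n : ℝ)⁻¹ • fun x => antidiv u ((n : ℝ) • x) := by
  ext x i j
  simp only [antidiv, (averagingOp_coordPrim _).comp_smul hu hn,
    (averagingOp_offDiagPrim _ _).comp_smul hu hn, Pi.smul_apply, smul_eq_mul]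
  ring

theorem eLpNorm_iteratedFDeriv_antidiv_le (hu : SmoothPer u) (n : ℕ) {p : ℝ≥0∞} (hp : 1 ≤ p) :
    eLpNorm (iteratedFDeriv ℝ n (antidiv u)) p (μbox d) ≤
      ((d * (d * 3) : ℝ≥0) : ℝ≥0∞) * eLpNorm (iteratedFDeriv ℝ n u) p (μbox d) := by
  set X := eLpNorm (iteratedFDeriv ℝ n u) p (μbox d)
  have hle : ∀ {c : ℕ → ℝ} {A : (Pt d → Vec d) → Pt d → Vec d}, AveragingOp c A →
      ∀ L : Vec d →L[ℝ] ℝ, ‖L‖ ≤ 1 →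
        eLpNorm (iteratedFDeriv ℝ n fun x => L (A u x)) p (μbox d) ≤ X := fun hA L hL =>
    (eLpNorm_iteratedFDeriv_clm_comp_le hL (hA.smoothPer hu).contDiff n p).trans
      (hA.eLpNorm_le hu n hp)
  have hadd : ∀ {f g : Pt d → ℝ}, ContDiff ℝ (⊤ : ℕ∞) f → ContDiff ℝ (⊤ : ℕ∞) g →
      eLpNorm (iteratedFDeriv ℝ n fun x => f x + g x) p (μbox d) ≤
        eLpNorm (iteratedFDeriv ℝ n f) p (μbox d) + eLpNorm (iteratedFDeriv ℝ n g) p (μbox d) :=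
    fun hf hg => eLpNorm_iteratedFDeriv_add_le hf hg n hp
  have hentry : ∀ i j : Fin d,
      eLpNorm (iteratedFDeriv ℝ n fun x => antidiv u x i j) p (μbox d) ≤ 3 * X := fun i j => by
    let δ : Vec d →L[ℝ] ℝ := (if i = j then (1 : ℝ) else 0) • ContinuousLinearMap.proj i
    have hδ : ‖δ‖ ≤ 1 := by
      rw [norm_smul]
      refine mul_le_one₀ ?_ (norm_nonneg _) (norm_proj_le_one i)
      split_ifs <;> simp
    have s1 := ((averagingOp_coordPrim i).smoothPer hu).contDiff
    have s2 := ((averagingOp_offDiagPrim i j).smoothPer hu).contDiff_apply i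
    have s3 := ((averagingOp_offDiagPrim j i).smoothPer hu).contDiff_apply j
    have b1 := hle (averagingOp_coordPrim i) δ hδ
    have b2 := hle (averagingOp_offDiagPrim i j) _ (norm_proj_le_one i)
    have b3 := hle (averagingOp_offDiagPrim j i) _ (norm_proj_le_one j)
    have s1' := δ.contDiff.comp s1
    calc _ ≤ _ := hadd (s1'.add s2) s3
      _ ≤ X + X + X := add_le_add ((hadd s1' s2).trans (add_le_add b1 b2)) b3
      _ = 3 * X := by ring
  have hd := hu.antidiv.contDiff
  calc _ ≤ ∑ i, eLpNorm (iteratedFDeriv ℝ n fun x => antidiv u x i) p (μbox d) :=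
        eLpNorm_iteratedFDeriv_pi_le hd n hp
    _ ≤ ∑ _i : Fin d, ∑ _j : Fin d, 3 * X := by
        refine Finset.sum_le_sum fun i _ => ?_
        exact (eLpNorm_iteratedFDeriv_pi_le (contDiff_pi.1 hd i) n hp).trans
          (Finset.sum_le_sum fun j _ => hentry i j)
    _ = _ := by
        simp
        ring

theorem eLpNorm_iteratedFDeriv_antidiv_comp_smul (hu : SmoothPer u) (i : ℕ) (p : ℝ≥0∞) {n : ℕ}
    (hn : n ≠ 0) :
    eLpNorm (iteratedFDeriv ℝ i (antidiv fun x => u ((n : ℝ) • x))) p (μbox d) =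
      (n : ℝ≥0∞) ^ ((i : ℝ) - 1) * eLpNorm (iteratedFDeriv ℝ i (antidiv u)) p (μbox d) := by
  have ha := hu.antidiv
  have hi : ContDiff ℝ i (antidiv u) := ha.contDiff.of_le (by exact_mod_cast le_top)
  have hcomp : ContDiff ℝ i fun x => antidiv u ((n : ℝ) • x) :=
    hi.comp (contDiff_const_smul (n : ℝ))
  have hn0 : (0 : ℝ) < n := by exact_mod_cast hn.bot_lt
  have h : iteratedFDeriv ℝ i (antidiv fun x => u ((n : ℝ) • x)) =
      ((n : ℝ) ^ ((i : ℝ) - 1)) • fun x => iteratedFDeriv ℝ i (antidiv u) ((n : ℝ) • x) := by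
    ext1 x
    rw [antidiv_comp_smul hu hn, iteratedFDeriv_const_smul_apply hcomp.contDiffAt,
      iteratedFDeriv_comp_const_smul _ hi,
      Pi.smul_apply, smul_smul, Real.rpow_sub_one hn0.ne', Real.rpow_natCast, div_eq_inv_mul]
  rw [h]
  refine (eLpNorm_const_smul ((n : ℝ) ^ ((i : ℝ) - 1))
    (fun x => iteratedFDeriv ℝ i (antidiv u) ((n : ℝ) • x)) p (μbox d)).trans ?_
  rw [eLpNorm_smul_of_zPer (ha.continuous_iteratedFDeriv i)
    (ha.zPer.iteratedFDeriv i) hn, Real.enorm_of_nonneg (by positivity),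
    ← ENNReal.ofReal_rpow_of_pos hn0, ENNReal.ofReal_natCast]

end Antidivergence

/-- **Symmetric antidivergence operator `div⁻¹`** (Proposition 3.5 (i)):
a linear operator from smooth zero-mean vector fields to smooth zero-mean
symmetric-matrix fields with `div (div⁻¹ u) = u`, bounded on `L^p` together with
all derivatives, and gaining a factor `λ^{i-1}` on `λ`-oscillating inputs. -/
theorem symmetric_antidivergence (d : ℕ) (hd : 1 ≤ d) :
    ∃ T : (Pt d → Vec d) → (Pt d → Mat d),
      -- mapping properties
      (∀ u, AdmissibleVec d u →
        ContDiff ℝ ((⊤:ℕ∞)) (T u) ∧ ZPer (T u) ∧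
        (∀ i j, (∫ x in box d, T u x i j) = 0) ∧
        (∀ x i j, T u x i j = T u x j i) ∧
        (∀ x, divMat (T u) x = u x)) ∧
      -- linearity
      (∀ u v, AdmissibleVec d u → AdmissibleVec d v →
        T (u + v) = T u + T v) ∧
      (∀ (c : ℝ) u, AdmissibleVec d u → T (c • u) = c • T u) ∧
      -- `L^p` estimates for all derivatives, and the oscillation gain
      (∀ (i : ℕ) (p : ℝ≥0∞), 1 ≤ p → ∃ C : ℝ≥0,
        (∀ u, AdmissibleVec d u →
          eLpNorm (fun x => iteratedFDeriv ℝ i (T u) x) p (μbox d)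
            ≤ C * eLpNorm (fun x => iteratedFDeriv ℝ i u x) p (μbox d)) ∧
        (∀ u, AdmissibleVec d u → ∀ lam : ℕ, 1 ≤ lam →
          eLpNorm (fun x => iteratedFDeriv ℝ i
              (T (fun y => u (fun j => (lam : ℝ) * y j))) x) p (μbox d)
            ≤ C * (lam : ℝ≥0∞) ^ ((i : ℝ) - 1)
              * eLpNorm (fun x => iteratedFDeriv ℝ i u x) p (μbox d))) := by
  refine ⟨antidiv, fun u hu => ⟨hu.smoothPer.antidiv.contDiff, hu.smoothPer.antidiv.zPer,
    integral_antidiv hu.smoothPer, antidiv_symm u, divMat_antidiv hu⟩,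
    fun u v hu hv => antidiv_add hu.smoothPer hv.smoothPer, fun c u _ => antidiv_smul c u,
    fun i p hp => ⟨d * (d * 3), fun u hu => eLpNorm_iteratedFDeriv_antidiv_le hu.smoothPer i hp,
      fun u hu lam hlam => ?_⟩⟩
  refine (eLpNorm_iteratedFDeriv_antidiv_comp_smul hu.smoothPer i p
    (Nat.one_le_iff_ne_zero.1 hlam)).trans_le ?_
  rw [mul_comm _ ((lam : ℝ≥0∞) ^ ((i : ℝ) - 1)), mul_assoc]
  gcongr
  exact eLpNorm_iteratedFDeriv_antidiv_le hu.smoothPer i hp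

end NonNewtonian
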